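/- arXiv:2505.14641 — 2 statements merged into one kernel-verified Lean document; each statement's English description precedes it below -/
import Mathlib

section
/- Let d ≥ 2 and q ≥ 4 be natural numbers, and let U be a subset of the vertices of the Hamming graph H(d,q) with |U| ≥ 3q^(d−1) + 1. Then the VC-dimension of (U, n(U)) is exactly 3. -/
/-- Two vertices of the Hamming graph `H(d,q,t)` (vertex set `(ZMod q)^d`) are adjacent
if and only if they differ in exactly `t` coordinates. -/
def hammingAdj {d q : ℕ} (t : ℕ) (x y : Fin d → ZMod q) : Prop :=
  (Finset.univ.filter fun i => x i ≠ y i).card = t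

/-- `W ⊆ U` is shattered by the neighborhoods `n(U)`: for every `S ⊆ W` there is a
vertex `u ∈ U` with `n(u) ∩ W = S`. -/
def Shatters {d q : ℕ} (t : ℕ) (U W : Finset (Fin d → ZMod q)) : Prop :=
  ∀ S ⊆ W, ∃ u ∈ U, ∀ w ∈ W, (w ∈ S ↔ hammingAdj t u w)

theorem hammingAdj_one_iff {d q : ℕ} {x y : Fin d → ZMod q} :
    hammingAdj 1 x y ↔ ∃ i, x i ≠ y i ∧ ∀ j, j ≠ i → x j = y j := by
  unfold hammingAdj
  rw [Finset.card_eq_one]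
  constructor
  · rintro ⟨i, hi⟩
    have h : ∀ j, x j ≠ y j ↔ j = i := fun j => by
      simpa using Finset.ext_iff.mp hi j
    exact ⟨i, (h i).2 rfl, fun j hj => by by_contra hne; exact hj ((h j).1 hne)⟩
  · rintro ⟨i, hi, h⟩
    refine ⟨i, Finset.ext fun j => ?_⟩
    simp only [Finset.mem_filter, Finset.mem_univ, true_and, Finset.mem_singleton]
    exact ⟨fun hj => by by_contra hne; exact hj (h j hne), fun hj => hj ▸ hi⟩

/-- Two vertices of `H(d,q)` at distance at least two have at most two common neighbours. -/
theorem hammingAdj_of_three_common_neighbors {d q : ℕ} {x y u v w : Fin d → ZMod q}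
    (hxy : x ≠ y) (huv : u ≠ v) (huw : u ≠ w) (hvw : v ≠ w)
    (hux : hammingAdj 1 u x) (huy : hammingAdj 1 u y)
    (hvx : hammingAdj 1 v x) (hvy : hammingAdj 1 v y)
    (hwx : hammingAdj 1 w x) (hwy : hammingAdj 1 w y) : hammingAdj 1 x y := by
  rw [hammingAdj_one_iff] at *
  by_contra hna
  have key : ∀ z : Fin d → ZMod q, (∃ i, z i ≠ x i ∧ ∀ j, j ≠ i → z j = x j) →
      (∃ i, z i ≠ y i ∧ ∀ j, j ≠ i → z j = y j) →
      ∃ i j, i ≠ j ∧ x i ≠ y i ∧ z i = y i ∧ (∀ k, k ≠ i → z k = x k) ∧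
        ∀ k, k ≠ i → k ≠ j → x k = y k := by
    rintro z ⟨i, hi, hi'⟩ ⟨j, hj, hj'⟩
    have hij : i ≠ j := by
      rintro rfl
      refine hna ⟨i, fun h => hxy (funext fun k => ?_), fun k hk => (hi' k hk).symm.trans (hj' k hk)⟩
      by_cases hk : k = i
      · exact hk ▸ h
      · exact (hi' k hk).symm.trans (hj' k hk)
    exact ⟨i, j, hij, fun h => hi ((hj' i hij).trans h.symm), hj' i hij, hi',
      fun k hk hk' => (hi' k hk).symm.trans (hj' k hk')⟩
  have same : ∀ (z z' : Fin d → ZMod q) (i : Fin d), z i = y i → z' i = y i →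
      (∀ k, k ≠ i → z k = x k) → (∀ k, k ≠ i → z' k = x k) → z = z' := by
    intro z z' i h1 h2 h3 h4
    funext k
    by_cases hk : k = i
    · rw [hk, h1, h2]
    · rw [h3 k hk, h4 k hk]
  obtain ⟨i, j, -, -, hi, hi', hu⟩ := key u hux huy
  obtain ⟨i₂, -, -, h₂, hi₂, hi₂', -⟩ := key v hvx hvy
  obtain ⟨i₃, -, -, h₃, hi₃, hi₃', -⟩ := key w hwx hwy
  have e₂ : i₂ ≠ i := fun h => huv (same u v i hi (h ▸ hi₂) hi' (h ▸ hi₂'))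
  have e₃ : i₃ ≠ i := fun h => huw (same u w i hi (h ▸ hi₃) hi' (h ▸ hi₃'))
  have e₂₃ : i₂ ≠ i₃ := fun h => hvw (same v w i₃ (h ▸ hi₂) hi₃ (h ▸ hi₂') hi₃')
  have f₂ : i₂ = j := by by_contra h; exact h₂ (hu i₂ e₂ h)
  have f₃ : i₃ = j := by by_contra h; exact h₃ (hu i₃ e₃ h)
  exact e₂₃ (f₂.trans f₃.symm)

/-- A common neighbour of two points of a line lies on that line. -/
theorem eq_off_line_of_hammingAdj {d q : ℕ} {x y z : Fin d → ZMod q} {i : Fin d}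
    (hi : x i ≠ y i) (h : ∀ j, j ≠ i → x j = y j)
    (hx : hammingAdj 1 z x) (hy : hammingAdj 1 z y) : ∀ j, j ≠ i → z j = x j := by
  obtain ⟨k, hk, hk'⟩ := hammingAdj_one_iff.1 hx
  obtain ⟨l, hl, hl'⟩ := hammingAdj_one_iff.1 hy
  by_cases hki : k = i
  · exact hki ▸ hk'
  · have hkl : k = l := by
      by_contra hne
      exact hk ((hl' k hne).trans (h k hki).symm)
    subst hkl
    exact absurd ((hk' i (Ne.symm hki)).symm.trans (hl' i (Ne.symm hki))) hi

theorem Shatters.hammingAdj_of_mem {d q : ℕ} {U W : Finset (Fin d → ZMod q)}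
    (hW : Shatters 1 U W) (hcard : 4 ≤ W.card) {x y : Fin d → ZMod q}
    (hx : x ∈ W) (hy : y ∈ W) (hxy : x ≠ y) : hammingAdj 1 x y := by
  have hpair : ({x, y} : Finset (Fin d → ZMod q)) ⊆ W := by
    simp [Finset.insert_subset_iff, hx, hy]
  have h2 : 1 < (W \ {x, y}).card := by
    rw [Finset.card_sdiff_of_subset hpair, Finset.card_pair hxy]
    omega
  obtain ⟨z, hz, t, ht, hzt⟩ := Finset.one_lt_card.1 h2
  simp only [Finset.mem_sdiff, Finset.mem_insert, Finset.mem_singleton, not_or] at hz ht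
  obtain ⟨hz, hzx, hzy⟩ := hz
  obtain ⟨ht, htx, hty⟩ := ht
  obtain ⟨u, -, hu⟩ := hW {x, y} hpair
  obtain ⟨v, -, hv⟩ := hW {x, y, z} (by simp [Finset.insert_subset_iff, hx, hy, hz])
  obtain ⟨w, -, hw⟩ := hW {x, y, t} (by simp [Finset.insert_subset_iff, hx, hy, ht])
  refine hammingAdj_of_three_common_neighbors (u := u) (v := v) (w := w) hxy ?_ ?_ ?_
    ((hu x hx).1 (by simp)) ((hu y hy).1 (by simp)) ((hv x hx).1 (by simp))
    ((hv y hy).1 (by simp)) ((hw x hx).1 (by simp)) ((hw y hy).1 (by simp))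
  · rintro rfl
    have := (hu z hz).2 ((hv z hz).1 (by simp))
    simp [hzx, hzy] at this
  · rintro rfl
    have := (hu t ht).2 ((hw t ht).1 (by simp))
    simp [htx, hty] at this
  · rintro rfl
    have := (hw z hz).2 ((hv z hz).1 (by simp))
    simp [hzx, hzy, hzt] at this

theorem Shatters.card_le_three {d q : ℕ} {U W : Finset (Fin d → ZMod q)}
    (hW : Shatters 1 U W) : W.card ≤ 3 := by
  by_contra! hcard
  obtain ⟨x, hx, y, hy, hxy⟩ := Finset.one_lt_card.1 (show 1 < W.card by omega)
  have hpair : ({x, y} : Finset (Fin d → ZMod q)) ⊆ W := by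
    simp [Finset.insert_subset_iff, hx, hy]
  have h2 : 1 < (W \ {x, y}).card := by
    rw [Finset.card_sdiff_of_subset hpair, Finset.card_pair hxy]
    omega
  obtain ⟨z, hz, t, ht, hzt⟩ := Finset.one_lt_card.1 h2
  obtain ⟨i, hi, hi'⟩ := hammingAdj_one_iff.1 (hW.hammingAdj_of_mem hcard hx hy hxy)
  obtain ⟨u, -, hu⟩ := hW {x, y} hpair
  have hu' := eq_off_line_of_hammingAdj hi hi' ((hu x hx).1 (by simp)) ((hu y hy).1 (by simp))
  have eq_of : ∀ s ∈ W \ {x, y}, u = s := by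
    intro s hs
    simp only [Finset.mem_sdiff, Finset.mem_insert, Finset.mem_singleton, not_or] at hs
    obtain ⟨hs, hsx, hsy⟩ := hs
    have hs' := eq_off_line_of_hammingAdj hi hi' (hW.hammingAdj_of_mem hcard hs hx hsx)
      (hW.hammingAdj_of_mem hcard hs hy hsy)
    have hus : ¬ hammingAdj 1 u s := fun h => by
      have := (hu s hs).2 h
      simp [hsx, hsy] at this
    funext j
    by_contra hne
    have hj : ∀ k, k ≠ i → u k = s k := fun k hk => (hu' k hk).trans (hs' k hk).symm
    have hji : j = i := by by_contra h; exact hne (hj j h)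
    subst hji
    exact hus (hammingAdj_one_iff.2 ⟨j, hne, hj⟩)
  exact hzt ((eq_of z hz).symm.trans (eq_of t ht))

/-- Four points of `E` on a common fibre of `f`, three of which have a further point of `E` on
their fibre of `g`. -/
def HasPreStar {ι α : Type*} (f g : ι → α) (E : Finset ι) (w₁ w₂ w₃ : ι) : Prop :=
  (w₁ ∈ E ∧ w₂ ∈ E ∧ w₃ ∈ E) ∧ (w₁ ≠ w₂ ∧ w₁ ≠ w₃ ∧ w₂ ≠ w₃) ∧ (f w₂ = f w₁ ∧ f w₃ = f w₁) ∧
  (∃ w ∈ E, f w = f w₁ ∧ w ≠ w₁ ∧ w ≠ w₂ ∧ w ≠ w₃) ∧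
  (∃ x ∈ E, x ≠ w₁ ∧ g x = g w₁) ∧ (∃ x ∈ E, x ≠ w₂ ∧ g x = g w₂) ∧
  (∃ x ∈ E, x ≠ w₃ ∧ g x = g w₃)

/-- A point of `E` on none of the fibres of `f` and `g` through `w₁`, `w₂`, `w₃`. -/
def HasFarPoint {ι α : Type*} (f g : ι → α) (E : Finset ι) (w₁ w₂ w₃ : ι) : Prop :=
  ∃ y ∈ E, f y ≠ f w₁ ∧ g y ≠ g w₁ ∧ g y ≠ g w₂ ∧ g y ≠ g w₃

section Grid

variable {ι α : Type*} [DecidableEq α]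

theorem exists_hasPreStar_of_card (f g : ι → α) (E : Finset ι) {a : α}
    (h4 : 4 ≤ (E.filter (f · = a)).card)
    (h3 : 2 < ((E.filter (f · = a)).filter fun p => (E.filter (g · = g p)).card ≠ 1).card) :
    ∃ w₁ w₂ w₃, HasPreStar f g E w₁ w₂ w₃ := by
  classical
  obtain ⟨w₁, h₁, w₂, h₂, w₃, h₃, h₁₂, h₁₃, h₂₃⟩ := Finset.two_lt_card.1 h3
  have mate : ∀ p ∈ E, (E.filter (g · = g p)).card ≠ 1 → ∃ x ∈ E, x ≠ p ∧ g x = g p := by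
    intro p hp hc
    have hmem : p ∈ E.filter (g · = g p) := by simp [hp]
    have : 1 < (E.filter (g · = g p)).card := by
      have := Finset.card_pos.2 ⟨p, hmem⟩
      omega
    obtain ⟨x, hx, hne⟩ := Finset.exists_mem_ne this p
    rw [Finset.mem_filter] at hx
    exact ⟨x, hx.1, hne, hx.2⟩
  have hlt : ({w₁, w₂, w₃} : Finset ι).card < (E.filter (f · = a)).card :=
    lt_of_le_of_lt Finset.card_le_three h4
  obtain ⟨w, hw, hw'⟩ := Finset.exists_mem_notMem_of_card_lt_card hlt
  simp only [Finset.mem_filter] at h₁ h₂ h₃ hw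
  simp only [Finset.mem_insert, Finset.mem_singleton, not_or] at hw'
  exact ⟨w₁, w₂, w₃, ⟨h₁.1.1, h₂.1.1, h₃.1.1⟩, ⟨h₁₂, h₁₃, h₂₃⟩,
    ⟨h₂.1.2.trans h₁.1.2.symm, h₃.1.2.trans h₁.1.2.symm⟩,
    ⟨w, hw.1, hw.2.trans h₁.1.2.symm, hw'⟩,
    mate _ h₁.1.1 h₁.2, mate _ h₂.1.1 h₂.2, mate _ h₃.1.1 h₃.2⟩

variable [Fintype α]

theorem sum_weight_le (f g : ι → α) (E : Finset ι)
    (h : ∀ a, 4 ≤ (E.filter (f · = a)).card →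
      ((E.filter (f · = a)).filter fun p => (E.filter (g · = g p)).card ≠ 1).card ≤ 2) :
    ∑ p ∈ E, (if (E.filter (f · = f p)).card = 1 then 2
      else if (E.filter (g · = g p)).card = 1 then 0 else 1) ≤ 3 * Fintype.card α := by
  rw [← Finset.sum_fiberwise_of_maps_to (s := E) (t := Finset.univ) (g := f) (by simp)]
  rw [mul_comm, ← smul_eq_mul, ← Finset.card_univ]
  refine Finset.sum_le_card_nsmul _ _ _ fun a _ => ?_
  by_cases ha : (E.filter (f · = a)).card = 1
  · have : ∀ p ∈ E.filter (f · = a), (if (E.filter (f · = f p)).card = 1 then 2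
        else if (E.filter (g · = g p)).card = 1 then 0 else 1) = 2 := by
      intro p hp
      rw [(Finset.mem_filter.1 hp).2, if_pos ha]
    rw [Finset.sum_congr rfl this]
    simp [ha]
  · have : ∀ p ∈ E.filter (f · = a), (if (E.filter (f · = f p)).card = 1 then 2
        else if (E.filter (g · = g p)).card = 1 then 0 else 1) =
        if (E.filter (g · = g p)).card ≠ 1 then 1 else 0 := by
      intro p hp
      rw [(Finset.mem_filter.1 hp).2, if_neg ha]
      simp
    rw [Finset.sum_congr rfl this, ← Finset.card_filter]
    have := h a
    have := Finset.card_filter_le (E.filter (f · = a))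
      fun p => (E.filter (g · = g p)).card ≠ 1
    omega

theorem exists_hasPreStar (f g : ι → α) (E : Finset ι) (hE : 3 * Fintype.card α + 1 ≤ E.card) :
    (∃ w₁ w₂ w₃, HasPreStar f g E w₁ w₂ w₃) ∨ ∃ w₁ w₂ w₃, HasPreStar g f E w₁ w₂ w₃ := by
  by_contra! hno
  have hf := sum_weight_le f g E fun a ha => by
    by_contra! hlt
    obtain ⟨w₁, w₂, w₃, h⟩ := exists_hasPreStar_of_card f g E ha hlt
    exact hno.1 w₁ w₂ w₃ h
  have hg := sum_weight_le g f E fun a ha => by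
    by_contra! hlt
    obtain ⟨w₁, w₂, w₃, h⟩ := exists_hasPreStar_of_card g f E ha hlt
    exact hno.2 w₁ w₂ w₃ h
  have hsum := Finset.card_nsmul_le_sum E
    (fun p => (if (E.filter (f · = f p)).card = 1 then 2
      else if (E.filter (g · = g p)).card = 1 then 0 else 1) +
      (if (E.filter (g · = g p)).card = 1 then 2
      else if (E.filter (f · = f p)).card = 1 then 0 else 1)) 2
    (fun p _ => by split_ifs <;> omega)
  rw [Finset.sum_add_distrib, smul_eq_mul] at hsum
  omega

theorem HasPreStar.exists_hasFarPoint_or {f g : ι → α} {E : Finset ι}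
    (hinj : ∀ x ∈ E, ∀ y ∈ E, f x = f y → g x = g y → x = y)
    (hE : 3 * Fintype.card α + 1 ≤ E.card) {w₁ w₂ w₃ : ι} (hw : HasPreStar f g E w₁ w₂ w₃) :
    HasFarPoint f g E w₁ w₂ w₃ ∨
      ∃ z₁ z₂ z₃, HasPreStar g f E z₁ z₂ z₃ ∧ HasFarPoint g f E z₁ z₂ z₃ := by
  classical
  rw [or_iff_not_imp_left]
  intro hfar
  obtain ⟨⟨h₁, h₂, h₃⟩, ⟨h₁₂, h₁₃, h₂₃⟩, ⟨f₂, f₃⟩, -⟩ := hw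
  have hcov : ∀ y ∈ E, f y ≠ f w₁ → g y ∈ ({g w₁, g w₂, g w₃} : Finset α) := by
    intro y hy hne
    simp only [Finset.mem_insert, Finset.mem_singleton]
    by_contra! h
    exact hfar ⟨y, hy, hne, h⟩
  have hinj' : ∀ a, Set.InjOn g (E.filter (f · = a)) := by
    intro a x hx y hy hxy
    simp only [Finset.coe_filter, Set.mem_ofPred_eq] at hx hy
    exact hinj x hx.1 y hy.1 (hx.2.trans hy.2.symm) hxy
  have himg : ∀ a, a ≠ f w₁ → (E.filter (f · = a)).image g ⊆ {g w₁, g w₂, g w₃} := by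
    intro a ha
    rw [Finset.image_subset_iff]
    intro y hy
    rw [Finset.mem_filter] at hy
    exact hcov y hy.1 (hy.2 ▸ ha)
  let F : Finset α := (Finset.univ.erase (f w₁)).filter fun a => 3 ≤ (E.filter (f · = a)).card
  have hF : 2 < F.card := by
    have hsum : E.card = ∑ a, (E.filter (f · = a)).card :=
      Finset.card_eq_sum_card_fiberwise (by simp)
    rw [← Finset.add_sum_erase _ _ (Finset.mem_univ (f w₁))] at hsum
    have hrow : (E.filter (f · = f w₁)).card ≤ Fintype.card α := by
      rw [← Finset.card_image_of_injOn (hinj' _)]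
      exact Finset.card_le_univ _
    have hrest : ∑ a ∈ Finset.univ.erase (f w₁), (E.filter (f · = a)).card ≤
        ∑ a ∈ Finset.univ.erase (f w₁),
          (2 + if 3 ≤ (E.filter (f · = a)).card then 1 else 0) := by
      refine Finset.sum_le_sum fun a ha => ?_
      have hle : (E.filter (f · = a)).card ≤ 3 := by
        rw [← Finset.card_image_of_injOn (hinj' a)]
        exact (Finset.card_le_card (himg a (Finset.ne_of_mem_erase ha))).trans
          Finset.card_le_three
      split_ifs <;> omega
    rw [Finset.sum_add_distrib, ← Finset.card_filter, Finset.sum_const, smul_eq_mul,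
      Finset.card_erase_of_mem (Finset.mem_univ _), Finset.card_univ] at hrest
    have hpos : 0 < Fintype.card α := Fintype.card_pos_iff.2 ⟨f w₁⟩
    change _ ≤ _ + F.card at hrest
    omega
  have hfull : ∀ a ∈ F, a ≠ f w₁ ∧ ∀ c ∈ ({g w₁, g w₂, g w₃} : Finset α),
      ∃ z ∈ E, f z = a ∧ g z = c := by
    intro a ha
    obtain ⟨ha, hc⟩ := Finset.mem_filter.1 ha
    have ha := Finset.ne_of_mem_erase ha
    refine ⟨ha, fun c hcm => ?_⟩
    have heq : (E.filter (f · = a)).image g = {g w₁, g w₂, g w₃} := by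
      refine Finset.eq_of_subset_of_card_le (himg a ha) ?_
      rw [Finset.card_image_of_injOn (hinj' a)]
      exact Finset.card_le_three.trans hc
    rw [← heq, Finset.mem_image] at hcm
    obtain ⟨z, hz, hzc⟩ := hcm
    rw [Finset.mem_filter] at hz
    exact ⟨z, hz.1, hz.2, hzc⟩
  have hg : g w₂ ≠ g w₁ := fun h => h₁₂ (hinj w₁ h₁ w₂ h₂ f₂.symm h.symm)
  obtain ⟨a₁, ha₁, a₂, ha₂, a₃, ha₃, a₁₂, a₁₃, a₂₃⟩ := Finset.two_lt_card.1 hF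
  obtain ⟨n₁, m₁⟩ := hfull a₁ ha₁
  obtain ⟨n₂, m₂⟩ := hfull a₂ ha₂
  obtain ⟨n₃, m₃⟩ := hfull a₃ ha₃
  obtain ⟨z₁, hz₁, fz₁, gz₁⟩ := m₁ (g w₁) (by simp)
  obtain ⟨z₂, hz₂, fz₂, gz₂⟩ := m₂ (g w₁) (by simp)
  obtain ⟨z₃, hz₃, fz₃, gz₃⟩ := m₃ (g w₁) (by simp)
  obtain ⟨x₁, hx₁, fx₁, gx₁⟩ := m₁ (g w₂) (by simp)
  obtain ⟨x₂, hx₂, fx₂, gx₂⟩ := m₂ (g w₂) (by simp)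
  obtain ⟨x₃, hx₃, fx₃, gx₃⟩ := m₃ (g w₂) (by simp)
  refine ⟨z₁, z₂, z₃, ⟨⟨hz₁, hz₂, hz₃⟩, ?_, ?_, ⟨w₁, h₁, gz₁.symm, ?_⟩, ⟨x₁, hx₁, ?_⟩,
    ⟨x₂, hx₂, ?_⟩, ⟨x₃, hx₃, ?_⟩⟩, ⟨w₂, h₂, ?_⟩⟩ <;> grind

theorem exists_star {f g : ι → α} {E : Finset ι}
    (hinj : ∀ x ∈ E, ∀ y ∈ E, f x = f y → g x = g y → x = y)
    (hE : 3 * Fintype.card α + 1 ≤ E.card) :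
    (∃ w₁ w₂ w₃, HasPreStar f g E w₁ w₂ w₃ ∧ HasFarPoint f g E w₁ w₂ w₃) ∨
      ∃ w₁ w₂ w₃, HasPreStar g f E w₁ w₂ w₃ ∧ HasFarPoint g f E w₁ w₂ w₃ := by
  rcases exists_hasPreStar f g E hE with ⟨w₁, w₂, w₃, h⟩ | ⟨w₁, w₂, w₃, h⟩
  · exact (h.exists_hasFarPoint_or hinj hE).imp (fun hf => ⟨w₁, w₂, w₃, h, hf⟩) id
  · exact ((h.exists_hasFarPoint_or (fun x hx y hy hg hf => hinj x hx y hy hf hg) hE).imp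
      (fun hf => ⟨w₁, w₂, w₃, h, hf⟩) id).symm

end Grid

theorem exists_shatters_of_star {α : Type*} {d q : ℕ} {U E : Finset (Fin d → ZMod q)}
    {f g : (Fin d → ZMod q) → α} (hEU : E ⊆ U)
    (hinj : ∀ x ∈ E, ∀ y ∈ E, f x = f y → g x = g y → x = y)
    (hadj : ∀ x ∈ E, ∀ y ∈ E, hammingAdj 1 x y ↔ x ≠ y ∧ (f x = f y ∨ g x = g y))
    {w₁ w₂ w₃ : Fin d → ZMod q} (hw : HasPreStar f g E w₁ w₂ w₃)
    (hfar : HasFarPoint f g E w₁ w₂ w₃) :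
    ∃ W ⊆ U, W.card = 3 ∧ Shatters 1 U W := by
  obtain ⟨⟨h₁, h₂, h₃⟩, ⟨h₁₂, h₁₃, h₂₃⟩, ⟨f₂, f₃⟩, ⟨w, hw, fw, n₁, n₂, n₃⟩, ⟨x₁, hx₁, nx₁, gx₁⟩,
    ⟨x₂, hx₂, nx₂, gx₂⟩, ⟨x₃, hx₃, nx₃, gx₃⟩⟩ := hw
  obtain ⟨y, hy, fy, gy₁, gy₂, gy₃⟩ := hfar
  refine ⟨{w₁, w₂, w₃}, ?_, Finset.card_eq_three.2 ⟨w₁, w₂, w₃, h₁₂, h₁₃, h₂₃, rfl⟩, ?_⟩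
  · simp [Finset.insert_subset_iff, hEU h₁, hEU h₂, hEU h₃]
  intro S _
  suffices h : ∃ u ∈ E, (w₁ ∈ S ↔ u ≠ w₁ ∧ (f u = f w₁ ∨ g u = g w₁)) ∧
      (w₂ ∈ S ↔ u ≠ w₂ ∧ (f u = f w₂ ∨ g u = g w₂)) ∧
      (w₃ ∈ S ↔ u ≠ w₃ ∧ (f u = f w₃ ∨ g u = g w₃)) by
    obtain ⟨u, hu, h⟩ := h
    refine ⟨u, hEU hu, ?_⟩
    simp only [Finset.mem_insert, Finset.mem_singleton, forall_eq_or_imp, forall_eq]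
    rwa [hadj u hu w₁ h₁, hadj u hu w₂ h₂, hadj u hu w₃ h₃]
  have g₁₂ : g w₁ ≠ g w₂ := fun h => h₁₂ (hinj _ h₁ _ h₂ f₂.symm h)
  have g₁₃ : g w₁ ≠ g w₃ := fun h => h₁₃ (hinj _ h₁ _ h₃ f₃.symm h)
  have g₂₃ : g w₂ ≠ g w₃ := fun h => h₂₃ (hinj _ h₂ _ h₃ (f₂.trans f₃.symm) h)
  have fx₁ : f x₁ ≠ f w₁ := fun h => nx₁ (hinj _ hx₁ _ h₁ h gx₁)
  have fx₂ : f x₂ ≠ f w₁ := fun h => nx₂ (hinj _ hx₂ _ h₂ (h.trans f₂.symm) gx₂)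
  have fx₃ : f x₃ ≠ f w₁ := fun h => nx₃ (hinj _ hx₃ _ h₃ (h.trans f₃.symm) gx₃)
  clear hinj hadj
  by_cases s₁ : w₁ ∈ S <;> by_cases s₂ : w₂ ∈ S <;> by_cases s₃ : w₃ ∈ S
  · exact ⟨w, hw, by grind⟩
  · exact ⟨w₃, h₃, by grind⟩
  · exact ⟨w₂, h₂, by grind⟩
  · exact ⟨x₁, hx₁, by grind⟩
  · exact ⟨w₁, h₁, by grind⟩
  · exact ⟨x₂, hx₂, by grind⟩
  · exact ⟨x₃, hx₃, by grind⟩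
  · exact ⟨y, hy, by grind⟩

/-- Adjacency of two vertices in a common plane spanned by the first two coordinates. -/
theorem hammingAdj_iff_of_tail_eq {e q : ℕ} {x y : Fin (e + 2) → ZMod q}
    (h : ∀ i : Fin e, x i.succ.succ = y i.succ.succ) :
    hammingAdj 1 x y ↔ x ≠ y ∧ (x 0 = y 0 ∨ x 1 = y 1) := by
  have hxy : x = y ↔ x 0 = y 0 ∧ x 1 = y 1 := by
    simp [funext_iff, Fin.forall_fin_succ, h]
  rw [hammingAdj, Finset.card_filter, Fin.sum_univ_succ, Fin.sum_univ_succ, ne_eq x y, hxy]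
  simp only [h]
  by_cases h0 : x 0 = y 0 <;> by_cases h1 : x 1 = y 1 <;> simp [h0, h1]

/-- if `d ≥ 2`, `q ≥ 4` and `U ⊆ V(H(d,q))` has `|U| ≥ 3q^(d-1)+1`,
then the VC-dimension of `(U, n(U))` is exactly 3. -/
theorem vc_dim_eq_three_of_card_gen (d q : ℕ) (hd : 2 ≤ d) (hq : 4 ≤ q)
    (U : Finset (Fin d → ZMod q)) (hU : 3 * q ^ (d - 1) + 1 ≤ U.card) :
    (∃ W ⊆ U, W.card = 3 ∧ Shatters 1 U W) ∧
    (∀ W ⊆ U, Shatters 1 U W → W.card ≤ 3) := by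
  refine ⟨?_, fun W _ hW => hW.card_le_three⟩
  obtain ⟨e, rfl⟩ : ∃ e, d = e + 2 := ⟨d - 2, by omega⟩
  have : NeZero q := ⟨by omega⟩
  let tail : (Fin (e + 2) → ZMod q) → Fin e → ZMod q := fun x i => x i.succ.succ
  obtain ⟨t, -, ht⟩ := Finset.exists_lt_card_fiber_of_mul_lt_card_of_maps_to
    (s := U) (t := Finset.univ) (f := tail) (n := 3 * q) (by simp) (by
      rw [Finset.card_univ, Fintype.card_fun, ZMod.card, Fintype.card_fin]
      have : q ^ (e + 2 - 1) = q ^ e * q := pow_succ q e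
      rw [this] at hU
      linarith)
  have htail : ∀ x ∈ U.filter (tail · = t), ∀ y ∈ U.filter (tail · = t),
      ∀ i : Fin e, x i.succ.succ = y i.succ.succ := by
    intro x hx y hy
    exact congrFun ((Finset.mem_filter.1 hx).2.trans (Finset.mem_filter.1 hy).2.symm)
  have hinj : ∀ x ∈ U.filter (tail · = t), ∀ y ∈ U.filter (tail · = t),
      x 0 = y 0 → x 1 = y 1 → x = y := by
    intro x hx y hy h0 h1
    simp [funext_iff, Fin.forall_fin_succ, h0, h1, htail x hx y hy]
  have hadj := fun x hx y hy => hammingAdj_iff_of_tail_eq (htail x hx y hy)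
  rcases exists_star (f := fun x : Fin (e + 2) → ZMod q => x 0)
    (g := fun x => x 1) hinj
    (by rw [ZMod.card]; exact ht) with ⟨w₁, w₂, w₃, h, hf⟩ | ⟨w₁, w₂, w₃, h, hf⟩
  · exact exists_shatters_of_star (Finset.filter_subset _ _) hinj hadj h hf
  · exact exists_shatters_of_star (Finset.filter_subset _ _)
      (fun x hx y hy h1 h0 => hinj x hx y hy h0 h1)
      (fun x hx y hy => by rw [hadj x hx y hy, or_comm]) h hf
end

section
/- For all natural numbers d ≥ 3 and q ≥ 6 there exists a subset U of the vertices of the Hamming graph H(d,q) with |U| = 3q^(d−1) such that the VC-dimension of (U, n(U)) is at most 2. -/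
theorem Shatters.mono {d q t : ℕ} {U W W' : Finset (Fin d → ZMod q)} (h : Shatters t U W)
    (hW : W' ⊆ W) : Shatters t U W' := fun S hS => by
  obtain ⟨u, hu, h⟩ := h S (hS.trans hW)
  exact ⟨u, hu, fun w hw => h w (hW hw)⟩

namespace HammingVC

theorem hammingAdj_one_iff {d q : ℕ} {x y : Fin d → ZMod q} :
    hammingAdj 1 x y ↔ ∃ i, x i ≠ y i ∧ ∀ k, k ≠ i → x k = y k := by
  unfold hammingAdj
  rw [Finset.card_eq_one]
  constructor
  · rintro ⟨i, hi⟩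
    simp only [Finset.ext_iff, Finset.mem_filter, Finset.mem_univ, true_and,
      Finset.mem_singleton] at hi
    exact ⟨i, (hi i).2 rfl, fun k hk => not_not.1 fun h => hk ((hi k).1 h)⟩
  · rintro ⟨i, hi, h⟩
    refine ⟨i, ?_⟩
    ext k
    simp only [Finset.mem_filter, Finset.mem_univ, true_and, Finset.mem_singleton]
    exact ⟨fun hk => not_not.1 fun hki => hk (h k hki), fun hk => hk ▸ hi⟩

theorem exists_eq_update {d q : ℕ} {x y : Fin d → ZMod q} (h : hammingAdj 1 x y) :
    ∃ i a, a ≠ x i ∧ y = Function.update x i a := by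
  obtain ⟨i, hi, h⟩ := hammingAdj_one_iff.1 h
  refine ⟨i, y i, hi.symm, ?_⟩
  ext k
  by_cases hk : k = i
  · subst hk; simp
  · simp [hk, h k hk]

/-- Common neighbors of two points on a line lie on that line. -/
theorem eq_update_of_adj_same {d q : ℕ} {u w : Fin d → ZMod q} {i : Fin d} {a b : ZMod q}
    (hab : a ≠ b) (ha : hammingAdj 1 w (Function.update u i a))
    (hb : hammingAdj 1 w (Function.update u i b)) :
    w = Function.update u i (w i) ∧ w i ≠ a ∧ w i ≠ b := by
  obtain ⟨m, hm, hma⟩ := hammingAdj_one_iff.1 ha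
  obtain ⟨n, hn, hnb⟩ := hammingAdj_one_iff.1 hb
  have him : m = i := by
    by_contra hmi
    have h1 := hma i (Ne.symm hmi)
    have hni : n = i := by
      by_contra hni
      have h2 := hnb i (Ne.symm hni)
      simp only [Function.update_self] at h1 h2
      exact hab (h1.symm.trans h2)
    have h3 := hnb m (by rw [hni]; exact hmi)
    simp only [Function.update_of_ne hmi] at h3 hm
    exact hm h3
  subst him
  have hnm : n = m := by
    by_contra hnm
    have h3 := hma n hnm
    simp only [Function.update_of_ne hnm] at h3 hn
    exact hn h3
  subst hnm
  simp only [Function.update_self] at hm hn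
  refine ⟨?_, hm, hn⟩
  ext k
  by_cases hk : k = n
  · subst hk; simp
  · simpa [hk] using hma k hk

/-- Two points in different directions from `u` have one common neighbor besides `u`. -/
theorem eq_update_of_adj_ne {d q : ℕ} {u w : Fin d → ZMod q} {i j : Fin d} {a b : ZMod q}
    (hij : i ≠ j) (ha : a ≠ u i) (hb : b ≠ u j) (hw : w ≠ u)
    (hwa : hammingAdj 1 w (Function.update u i a))
    (hwb : hammingAdj 1 w (Function.update u j b)) :
    w = Function.update (Function.update u i a) j b := by
  obtain ⟨m, hm, hma⟩ := hammingAdj_one_iff.1 hwa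
  obtain ⟨n, hn, hnb⟩ := hammingAdj_one_iff.1 hwb
  by_contra hne
  obtain ⟨k, hk⟩ := Function.ne_iff.1 hw
  obtain ⟨l, hl⟩ := Function.ne_iff.1 hne
  have := hma i; have := hma j; have := hnb i; have := hnb j
  have := hma k; have := hma l; have := hnb k; have := hnb l
  simp only [Function.update_apply] at *
  grind

theorem ofFn_update {α β : Type*} {d : ℕ} (φ : α → β) (u : Fin d → α) (i : Fin d) (v : α) :
    (List.ofFn fun k => φ (Function.update u i v k)) =
      (List.ofFn fun k => φ (u k)).set i (φ v) := by
  apply List.ext_getElem (by simp)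
  intro n _ _
  simp only [List.getElem_ofFn, List.getElem_set, Function.update_apply, Fin.ext_iff]
  split_ifs <;> first | rfl | omega

section GroupProduct

variable {G : Type*} [Group G] {d q : ℕ} (φ : ZMod q → G)

/-- The ordered product of the images of the coordinates. -/
def coordProd (u : Fin d → ZMod q) : G := (List.ofFn fun i => φ (u i)).prod

/-- The product of the images of the coordinates after the `i`-th. -/
def tailProd (u : Fin d → ZMod q) (i : Fin d) : G :=
  ((List.ofFn fun k => φ (u k)).drop (i + 1)).prod

/-- The factor by which `coordProd` changes when the `i`-th coordinate becomes `v`. -/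
def changeFactor (u : Fin d → ZMod q) (i : Fin d) (v : ZMod q) : G :=
  (tailProd φ u i)⁻¹ * (φ (u i))⁻¹ * φ v * tailProd φ u i

theorem exists_coordProd_update (u : Fin d → ZMod q) (i : Fin d) :
    ∃ p, ∀ v, coordProd φ (Function.update u i v) = p * φ v * tailProd φ u i := by
  refine ⟨((List.ofFn fun k => φ (u k)).take i).prod, fun v => ?_⟩
  simp [coordProd, tailProd, ofFn_update, List.prod_set]

theorem coordProd_update (u : Fin d → ZMod q) (i : Fin d) (v : ZMod q) :
    coordProd φ (Function.update u i v) = coordProd φ u * changeFactor φ u i v := by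
  obtain ⟨p, hp⟩ := exists_coordProd_update φ u i
  have h := hp (u i)
  rw [Function.update_eq_self] at h
  rw [h, hp, changeFactor]
  group

theorem changeFactor_update {i j : Fin d} (hij : i < j) (u : Fin d → ZMod q) (v w : ZMod q) :
    changeFactor φ (Function.update u i v) j w = changeFactor φ u j w := by
  have : tailProd φ (Function.update u i v) j = tailProd φ u j := by
    unfold tailProd
    rw [ofFn_update, List.drop_set_of_lt (by have := Fin.lt_def.1 hij; omega)]
  simp [changeFactor, this, hij.ne']

theorem changeFactor_ne_one {φ : ZMod q → G} (hφ : Function.Injective φ) {u : Fin d → ZMod q}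
    {i : Fin d} {v : ZMod q} (hv : v ≠ u i) : changeFactor φ u i v ≠ 1 := by
  intro h
  apply hv
  apply hφ
  have h' : (φ (u i))⁻¹ * φ v = 1 := by
    have := congrArg (fun g => tailProd φ u i * g * (tailProd φ u i)⁻¹) h
    simpa [changeFactor, mul_assoc] using this
  exact (inv_mul_eq_one.1 h').symm

end GroupProduct

section Construction

variable {G : Type*} [Group G] [DecidableEq G] {q : ℕ} [NeZero q] {φ : ZMod q → G}
  {A : Finset G}

theorem card_coordProd_mem
    (hline : ∀ p r : G, (Finset.univ.filter fun v => p * φ v * r ∈ A).card = 3) (n : ℕ) :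
    (Finset.univ.filter fun u : Fin (n + 1) → ZMod q => coordProd φ u ∈ A).card =
      3 * q ^ n := by
  rw [Finset.card_filter,
    ← (Fin.consEquiv fun _ : Fin (n + 1) => ZMod q).sum_comp, Fintype.sum_prod_type_right]
  have h (t : Fin n → ZMod q) :
      (∑ v : ZMod q, if coordProd φ (Fin.consEquiv (fun _ : Fin (n + 1) => ZMod q) (v, t)) ∈ A
        then 1 else 0) = 3 := by
    rw [← Finset.card_filter, ← hline 1 (coordProd φ t)]
    simp [coordProd, List.ofFn_succ, Fin.consEquiv]
  rw [Finset.sum_congr rfl fun t _ => h t]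
  simp [mul_comm]

variable {d : ℕ}

theorem card_le_two_of_shatters (hφ : Function.Injective φ)
    (hline : ∀ p r : G, (Finset.univ.filter fun v => p * φ v * r ∈ A).card = 3)
    (hcube : ∀ s ∈ A, ∀ a, a ≠ 1 → s * a ∈ A → ∀ b, b ≠ 1 → s * b ∈ A → s * a * b ∈ A →
      ∀ c, c ≠ 1 → s * c ∈ A → s * a * c ∈ A → s * b * c ∈ A → False)
    {U W : Finset (Fin d → ZMod q)} (hU : ∀ u, u ∈ U ↔ coordProd φ u ∈ A)
    (hWU : W ⊆ U) (hW : Shatters 1 U W) : W.card ≤ 2 := by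
  by_contra! hcard
  obtain ⟨T, hTW, hT⟩ := Finset.exists_subset_card_eq (show 3 ≤ W.card from hcard)
  obtain ⟨x, y, z, hxy, hxz, hyz, rfl⟩ := Finset.card_eq_three.1 hT
  have hTU := hTW.trans hWU
  replace hW := hW.mono hTW
  obtain ⟨u, hu, huW⟩ := hW _ (Finset.Subset.refl _)
  have pair : ∀ x' ∈ ({x, y, z} : Finset (Fin d → ZMod q)),
      ∀ y' ∈ ({x, y, z} : Finset (Fin d → ZMod q)),
      ∀ z' ∈ ({x, y, z} : Finset (Fin d → ZMod q)), x' ≠ z' → y' ≠ z' →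
      ∃ w ∈ U, w ≠ u ∧ hammingAdj 1 w x' ∧ hammingAdj 1 w y' := by
    intro x' hx' y' hy' z' hz' hxz' hyz'
    obtain ⟨w, hw, hwW⟩ := hW {x', y'} (by
      intro t ht; rcases Finset.mem_insert.1 ht with rfl | ht
      · exact hx'
      · rw [Finset.mem_singleton.1 ht]; exact hy')
    refine ⟨w, hw, ?_, (hwW x' hx').1 (by simp), (hwW y' hy').1 (by simp)⟩
    rintro rfl
    have := (hwW z' hz').2 ((huW z' hz').1 hz')
    simp [hxz'.symm, hyz'.symm] at this
  have line : ∀ i a b w, a ≠ u i → b ≠ u i → a ≠ b → w ∈ U → w ≠ u →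
      Function.update u i a ∈ U → Function.update u i b ∈ U →
      hammingAdj 1 w (Function.update u i a) → hammingAdj 1 w (Function.update u i b) →
      False := by
    intro i a b w ha hb hab hw hwu haU hbU hwa hwb
    obtain ⟨hwi, hwa', hwb'⟩ := eq_update_of_adj_same hab hwa hwb
    have hwu' : w i ≠ u i := fun h => hwu (by rw [hwi, h, Function.update_eq_self])
    obtain ⟨p, hp⟩ := exists_coordProd_update φ u i
    have hsub : ({u i, a, b, w i} : Finset (ZMod q)) ⊆
        Finset.univ.filter fun v => p * φ v * tailProd φ u i ∈ A := by
      intro v hv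
      simp only [Finset.mem_insert, Finset.mem_singleton] at hv
      simp only [Finset.mem_filter, Finset.mem_univ, true_and]
      rw [← hp, ← hU]
      rcases hv with rfl | rfl | rfl | rfl
      · rwa [Function.update_eq_self]
      · exact haU
      · exact hbU
      · rwa [← hwi]
    have := Finset.card_le_card hsub
    rw [hline, Finset.card_eq_of_equiv_fin (n := 4)] at this
    · omega
    · apply Finset.equivFinOfCardEq
      rw [Finset.card_insert_of_notMem (by simp [ha.symm, hb.symm, hwu'.symm]),
        Finset.card_insert_of_notMem (by simp [hab, hwa'.symm]), Finset.card_pair hwb'.symm]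
  have cube : ∀ i j k a b c, i < j → j < k → a ≠ u i → b ≠ u j → c ≠ u k →
      Function.update u i a ∈ U → Function.update u j b ∈ U → Function.update u k c ∈ U →
      Function.update (Function.update u i a) j b ∈ U →
      Function.update (Function.update u i a) k c ∈ U →
      Function.update (Function.update u j b) k c ∈ U → False := by
    intro i j k a b c hij hjk ha hb hc haU hbU hcU habU hacU hbcU
    simp only [hU, coordProd_update, changeFactor_update φ hij, changeFactor_update φ hjk,
      changeFactor_update φ (hij.trans hjk)] at *
    exact hcube _ hu _ (changeFactor_ne_one hφ ha) haU _ (changeFactor_ne_one hφ hb) hbU habU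
      _ (changeFactor_ne_one hφ hc) hcU hacU hbcU
  have hx : x ∈ ({x, y, z} : Finset (Fin d → ZMod q)) := by simp
  have hy : y ∈ ({x, y, z} : Finset (Fin d → ZMod q)) := by simp
  have hz : z ∈ ({x, y, z} : Finset (Fin d → ZMod q)) := by simp
  obtain ⟨w₁, hw₁, hw₁u, hw₁x, hw₁y⟩ := pair x hx y hy z hz hxz hyz
  obtain ⟨w₂, hw₂, hw₂u, hw₂x, hw₂z⟩ := pair x hx z hz y hy hxy hyz.symm
  obtain ⟨w₃, hw₃, hw₃u, hw₃y, hw₃z⟩ := pair y hy z hz x hx hxy.symm hxz.symm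
  have hxU := hTU hx
  have hyU := hTU hy
  have hzU := hTU hz
  obtain ⟨i, a, ha, hxa⟩ := exists_eq_update ((huW x hx).1 hx)
  obtain ⟨j, b, hb, hyb⟩ := exists_eq_update ((huW y hy).1 hy)
  obtain ⟨k, c, hc, hzc⟩ := exists_eq_update ((huW z hz).1 hz)
  clear pair hx hy hz huW hW hTU hTW hT
  subst hxa hyb hzc
  rcases eq_or_ne i j with rfl | hij
  · exact line i a b w₁ ha hb (by rintro rfl; exact hxy rfl) hw₁ hw₁u hxU hyU hw₁x hw₁y
  rcases eq_or_ne i k with rfl | hik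
  · exact line i a c w₂ ha hc (by rintro rfl; exact hxz rfl) hw₂ hw₂u hxU hzU hw₂x hw₂z
  rcases eq_or_ne j k with rfl | hjk
  · exact line j b c w₃ hb hc (by rintro rfl; exact hyz rfl) hw₃ hw₃u hyU hzU hw₃y hw₃z
  have hab := eq_update_of_adj_ne hij ha hb hw₁u hw₁x hw₁y ▸ hw₁
  have hac := eq_update_of_adj_ne hik ha hc hw₂u hw₂x hw₂z ▸ hw₂
  have hbc := eq_update_of_adj_ne hjk hb hc hw₃u hw₃y hw₃z ▸ hw₃
  have hba := Function.update_comm hij a b u ▸ hab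
  have hca := Function.update_comm hik a c u ▸ hac
  have hcb := Function.update_comm hjk b c u ▸ hbc
  rcases hij.lt_or_gt with h1 | h1 <;> rcases hjk.lt_or_gt with h2 | h2 <;>
    rcases hik.lt_or_gt with h3 | h3
  · exact cube i j k a b c h1 h2 ha hb hc hxU hyU hzU hab hac hbc
  · exact absurd (h1.trans h2) h3.not_gt
  · exact cube i k j a c b h3 h2 ha hc hb hxU hzU hyU hac hab hcb
  · exact cube k i j c a b h3 h1 hc ha hb hzU hxU hyU hca hcb hab
  · exact cube j i k b a c h1 h3 hb ha hc hyU hxU hzU hba hbc hac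
  · exact cube j k i b c a h2 h3 hb hc ha hyU hzU hxU hbc hba hca
  · exact absurd (h2.trans h1) h3.not_gt
  · exact cube k j i c b a h2 h1 hc hb ha hzU hyU hxU hcb hca hba

theorem exists_of_group (hφ : Function.Injective φ)
    (hline : ∀ p r : G, (Finset.univ.filter fun v => p * φ v * r ∈ A).card = 3)
    (hcube : ∀ s ∈ A, ∀ a, a ≠ 1 → s * a ∈ A → ∀ b, b ≠ 1 → s * b ∈ A → s * a * b ∈ A →
      ∀ c, c ≠ 1 → s * c ∈ A → s * a * c ∈ A → s * b * c ∈ A → False) (hd : d ≠ 0) :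
    ∃ U : Finset (Fin d → ZMod q),
      U.card = 3 * q ^ (d - 1) ∧ (∀ W ⊆ U, Shatters 1 U W → W.card ≤ 2) := by
  obtain ⟨n, rfl⟩ := Nat.exists_eq_succ_of_ne_zero hd
  exact ⟨_, card_coordProd_mem hline n,
    fun W hWU hW => card_le_two_of_shatters hφ hline hcube (by simp) hWU hW⟩

end Construction

theorem zmod_natCast_ne_zero {q k : ℕ} (hk : 0 < k) (hkq : k < q) : (k : ZMod q) ≠ 0 := by
  rw [Ne, ZMod.natCast_eq_zero_iff]
  exact Nat.not_dvd_of_pos_of_lt hk hkq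

/-- `{0, 1, 3}` has no nontrivial three-term progression modulo `q ≥ 7`. -/
theorem eq_zero_of_progression {q : ℕ} (hq : 7 ≤ q) {s a : ZMod q}
    (h₀ : s ∈ ({0, 1, 3} : Finset (ZMod q))) (h₁ : s + a ∈ ({0, 1, 3} : Finset (ZMod q)))
    (h₂ : s + a + a ∈ ({0, 1, 3} : Finset (ZMod q))) : a = 0 := by
  have n1 := zmod_natCast_ne_zero (k := 1) (by norm_num) (show 1 < q by omega)
  have n2 := zmod_natCast_ne_zero (k := 2) (by norm_num) (show 2 < q by omega)
  have n3 := zmod_natCast_ne_zero (k := 3) (by norm_num) (show 3 < q by omega)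
  have n4 := zmod_natCast_ne_zero (k := 4) (by norm_num) (show 4 < q by omega)
  have n5 := zmod_natCast_ne_zero (k := 5) (by norm_num) (show 5 < q by omega)
  have n6 := zmod_natCast_ne_zero (k := 6) (by norm_num) (show 6 < q by omega)
  push_cast at n1 n2 n3 n4 n5 n6
  simp only [Finset.mem_insert, Finset.mem_singleton] at h₀ h₁ h₂
  grind

theorem exists_of_seven_le (d q : ℕ) (hd : d ≠ 0) (hq : 7 ≤ q) :
    ∃ U : Finset (Fin d → ZMod q),
      U.card = 3 * q ^ (d - 1) ∧ (∀ W ⊆ U, Shatters 1 U W → W.card ≤ 2) := by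
  have : NeZero q := ⟨by omega⟩
  have n1 := zmod_natCast_ne_zero (k := 1) (by norm_num) (show 1 < q by omega)
  have n2 := zmod_natCast_ne_zero (k := 2) (by norm_num) (show 2 < q by omega)
  have n3 := zmod_natCast_ne_zero (k := 3) (by norm_num) (show 3 < q by omega)
  push_cast at n1 n2 n3
  let B : Finset (ZMod q) := {0, 1, 3}
  have hB : B.card = 3 := Finset.card_eq_three.2
    ⟨0, 1, 3, n1.symm, n3.symm, fun h => n2 (by linear_combination -h), rfl⟩
  refine exists_of_group (G := Multiplicative (ZMod q)) (φ := Multiplicative.ofAdd)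
    (A := B.map Multiplicative.ofAdd.toEmbedding) Multiplicative.ofAdd.injective ?_ ?_ hd
  · intro p r
    rw [← hB]
    refine Finset.card_equiv ((Equiv.addLeft p.toAdd).trans (Equiv.addRight r.toAdd)) ?_
    intro v
    simp only [Finset.mem_filter, Finset.mem_univ, true_and, Finset.mem_map_equiv]
    rfl
  · simp only [Finset.mem_map_equiv, Multiplicative.forall, ← ofAdd_add,
      Multiplicative.ofAdd_symm_eq, toAdd_ofAdd, ne_eq, ofAdd_eq_one]
    intro s hs a ha hsa b hb hsb hab c hc hsc hac hbc
    have haa : a ≠ b := by rintro rfl; exact ha (eq_zero_of_progression hq hs hsa hab)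
    have hcc : a ≠ c := by rintro rfl; exact ha (eq_zero_of_progression hq hs hsa hac)
    have hbb : b ≠ c := by rintro rfl; exact hb (eq_zero_of_progression hq hs hsb hbc)
    simp only [B, Finset.mem_insert, Finset.mem_singleton] at hs hsa hsb hsc
    clear hab hac hbc
    grind

/-- Three cosets of the center `{1, -1}` of the quaternion group of order eight. -/
def quaternionCoord (v : ZMod 6) : QuaternionGroup 2 :=
  ![.a 0, .a 1, .a 2, .a 3, .xa 0, .xa 2] v

/-- `{1, i, j, k}`, which meets every coset of the center `{1, -1}` exactly once. -/
def quaternionTransversal : Finset (QuaternionGroup 2) := {.a 0, .a 1, .xa 0, .xa 1}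

theorem exists_of_six (d : ℕ) (hd : d ≠ 0) :
    ∃ U : Finset (Fin d → ZMod 6),
      U.card = 3 * 6 ^ (d - 1) ∧ (∀ W ⊆ U, Shatters 1 U W → W.card ≤ 2) :=
  exists_of_group (φ := quaternionCoord) (A := quaternionTransversal) (by decide) (by decide)
    (by decide) hd

end HammingVC

/-- for all `d ≥ 3`, `q ≥ 6` there is `U ⊆ V(H(d,q))` with `|U| = 3q^(d-1)`
whose VC-dimension is at most 2. -/
theorem exists_vc_dim_le_two_Hdq (d q : ℕ) (hd : 3 ≤ d) (hq : 6 ≤ q) :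
    ∃ U : Finset (Fin d → ZMod q),
      U.card = 3 * q ^ (d - 1) ∧
      (∀ W ⊆ U, Shatters 1 U W → W.card ≤ 2) := by
  rcases hq.eq_or_lt with rfl | hq
  · exact HammingVC.exists_of_six d (by omega)
  · exact HammingVC.exists_of_seven_le d q (by omega) hq
end
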